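/- arXiv:0705.4640 — 7 statements merged into one kernel-verified Lean document; each statement's English description precedes it below -/
import Mathlib

section
/- For real numbers m and n with 0 < m < n, the integral of x^(m-1)/(1+x^n) over x from 0 to infinity equals π/(n·sin(mπ/n)). -/
theorem image_div_one_sub_Ioo_zero_one :
    (fun t : ℝ => t / (1 - t)) '' Set.Ioo 0 1 = Set.Ioi 0 := by
  ext y
  simp only [Set.mem_image, Set.mem_Ioo, Set.mem_Ioi]
  constructor
  · rintro ⟨t, ⟨h0, h1⟩, rfl⟩
    exact div_pos h0 (sub_pos.2 h1)
  · intro hy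
    have h : 0 < 1 + y := by positivity
    refine ⟨y / (1 + y), ⟨by positivity, (div_lt_one h).2 (by linarith)⟩, ?_⟩
    have h' : 1 - y / (1 + y) = 1 / (1 + y) := by field_simp; ring
    rw [h']
    field_simp

theorem injOn_div_one_sub_Ioo_zero_one :
    Set.InjOn (fun t : ℝ => t / (1 - t)) (Set.Ioo 0 1) := by
  intro s hs t ht h
  have hs' : 1 - s ≠ 0 := (sub_pos.2 hs.2).ne'
  have ht' : 1 - t ≠ 0 := (sub_pos.2 ht.2).ne'
  have := (div_eq_div_iff hs' ht').1 h
  linarith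

theorem hasDerivAt_div_one_sub {t : ℝ} (ht : 1 - t ≠ 0) :
    HasDerivAt (fun t : ℝ => t / (1 - t)) (((1 - t) ^ 2)⁻¹) t := by
  convert! (hasDerivAt_id t).div ((hasDerivAt_id t).const_sub 1) ht using 1
  simp only [id]
  field_simp
  ring

theorem integral_rpow_mul_one_add_rpow_eq_beta {a b : ℝ} (ha : 0 < a) (hb : 0 < b) :
    ∫ y in Set.Ioi (0 : ℝ), y ^ (a - 1) * (1 + y) ^ (-(a + b)) = ProbabilityTheory.beta a b := by
  have hbeta : ProbabilityTheory.beta a b =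
      ∫ t in Set.Ioo (0 : ℝ) 1, t ^ (a - 1) * (1 - t) ^ (b - 1) := by
    rw [← Complex.ofReal_inj, ProbabilityTheory.beta_eq_betaIntegralReal a b ha hb,
      ← MeasureTheory.integral_Ioc_eq_integral_Ioo, ← intervalIntegral.integral_of_le zero_le_one]
    have key : Complex.betaIntegral a b =
        ((∫ t in (0 : ℝ)..1, t ^ (a - 1) * (1 - t) ^ (b - 1) : ℝ) : ℂ) := by
      rw [Complex.betaIntegral, ← intervalIntegral.integral_ofReal]
      refine intervalIntegral.integral_congr fun t ht => ?_
      rw [Set.uIcc_of_le zero_le_one] at ht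
      simp only [Complex.ofReal_mul]
      rw [Complex.ofReal_cpow ht.1, Complex.ofReal_cpow (sub_nonneg.2 ht.2)]
      push_cast
      rfl
    rw [key, Complex.ofReal_re]
  rw [hbeta, ← image_div_one_sub_Ioo_zero_one,
    MeasureTheory.integral_image_eq_integral_abs_deriv_smul measurableSet_Ioo
      (fun t ht => (hasDerivAt_div_one_sub (sub_pos.2 ht.2).ne').hasDerivWithinAt)
      injOn_div_one_sub_Ioo_zero_one]
  refine MeasureTheory.setIntegral_congr_fun measurableSet_Ioo fun t ht => ?_
  have hs : 0 < 1 - t := sub_pos.2 ht.2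
  have h : 1 + t / (1 - t) = (1 - t)⁻¹ := by field_simp; ring
  have hsq : ((1 - t) ^ 2)⁻¹ = (1 - t) ^ (-2 : ℝ) := by
    rw [Real.rpow_neg hs.le, Real.rpow_ofNat]
  have hexp : b - 1 = -2 + (-(a - 1) + (a + b)) := by ring
  simp only [smul_eq_mul]
  rw [abs_of_pos (by positivity), h, Real.div_rpow ht.1.le hs.le, Real.inv_rpow hs.le,
    Real.rpow_neg hs.le, inv_inv, hsq, hexp, Real.rpow_add hs (-2), Real.rpow_add hs (-(a - 1)),
    Real.rpow_neg hs.le (a - 1)]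
  ring

theorem integral_rpow_div_one_add {a : ℝ} (h0 : 0 < a) (h1 : a < 1) :
    ∫ y in Set.Ioi (0 : ℝ), y ^ (a - 1) / (1 + y) = Real.pi / Real.sin (Real.pi * a) := by
  rw [← Real.Gamma_mul_Gamma_one_sub]
  simpa [ProbabilityTheory.beta, Real.rpow_neg_one, div_eq_mul_inv] using
    integral_rpow_mul_one_add_rpow_eq_beta h0 (sub_pos.2 h1)

theorem integral_rpow_div_one_add_rpow (m n : ℝ) (hm : 0 < m) (hmn : m < n) :
    ∫ x in Set.Ioi (0:ℝ), x ^ (m - 1) / (1 + x ^ n) =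
      Real.pi / (n * Real.sin (m * Real.pi / n)) := by
  have hn : 0 < n := hm.trans hmn
  have hint := integral_rpow_div_one_add (div_pos hm hn) ((div_lt_one hn).2 hmn)
  rw [← MeasureTheory.integral_comp_rpow_Ioi_of_pos hn] at hint
  have hcongr : ∫ x in Set.Ioi (0 : ℝ), (n * x ^ (n - 1)) • ((x ^ n) ^ (m / n - 1) / (1 + x ^ n)) =
      ∫ x in Set.Ioi (0 : ℝ), n * (x ^ (m - 1) / (1 + x ^ n)) := by
    refine MeasureTheory.setIntegral_congr_fun measurableSet_Ioi fun x hx => ?_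
    have hexp : m - 1 = (n - 1) + n * (m / n - 1) := by field_simp; ring
    simp only [smul_eq_mul]
    rw [hexp, Real.rpow_add hx, ← Real.rpow_mul (le_of_lt hx)]
    ring
  rw [hcongr, MeasureTheory.integral_const_mul] at hint
  rw [mul_comm n, ← div_div, eq_div_iff hn.ne', mul_comm, hint]
  congr 2
  ring
end

section
/- (Theorem I) Let n > 0 be real, let p and q be positive real numbers, set f = √(p² + q²) and θ = arctan(q/p). Then the integral of x^(n-1)·e^(-px)·cos(qx) over x from 0 to infinity equals Γ(n)·cos(nθ)/f^n. -/
open MeasureTheory Set Filter Topology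

lemma norm_rpow_mul_cexp_neg_mul (a : ℝ) (z : ℂ) {t : ℝ} (ht : 0 < t) :
    ‖((t ^ a : ℝ) : ℂ) * Complex.exp (-(z * t))‖ = t ^ a * Real.exp (-(z.re * t)) := by
  rw [norm_mul, Complex.norm_real, Real.norm_of_nonneg (Real.rpow_nonneg ht.le a),
    Complex.norm_exp]
  simp

lemma integrableOn_rpow_mul_exp_neg_mul {a r : ℝ} (ha : -1 < a) (hr : 0 < r) :
    IntegrableOn (fun t : ℝ => t ^ a * Real.exp (-(r * t))) (Ioi 0) := by
  simpa using integrableOn_rpow_mul_exp_neg_mul_rpow ha one_pos hr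

lemma integrableOn_rpow_mul_cexp_neg_mul {a : ℝ} {z : ℂ} (ha : -1 < a) (hz : 0 < z.re) :
    IntegrableOn (fun t : ℝ => ((t ^ a : ℝ) : ℂ) * Complex.exp (-(z * t))) (Ioi 0) := by
  refine (integrableOn_rpow_mul_exp_neg_mul ha hz).mono' (by fun_prop) ?_
  exact ae_restrict_of_forall_mem measurableSet_Ioi fun t ht =>
    (norm_rpow_mul_cexp_neg_mul a z ht).le

lemma hasDerivAt_integral_rpow_mul_cexp_neg_mul {a : ℝ} {z : ℂ} (ha : -1 < a) (hz : 0 < z.re) :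
    HasDerivAt (fun w : ℂ => ∫ t in Ioi (0:ℝ), ((t ^ a : ℝ) : ℂ) * Complex.exp (-(w * t)))
      (∫ t in Ioi (0:ℝ), -(t * (((t ^ a : ℝ) : ℂ) * Complex.exp (-(z * t))))) z := by
  have hs : {w : ℂ | z.re / 2 < w.re} ∈ 𝓝 z :=
    (isOpen_lt continuous_const Complex.continuous_re).mem_nhds (half_lt_self hz)
  refine (hasDerivAt_integral_of_dominated_loc_of_deriv_le
    (μ := volume.restrict (Ioi (0:ℝ)))
    (F := fun w (t : ℝ) => ((t ^ a : ℝ) : ℂ) * Complex.exp (-(w * t)))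
    (F' := fun w (t : ℝ) => -(t * (((t ^ a : ℝ) : ℂ) * Complex.exp (-(w * t)))))
    (bound := fun t : ℝ => t ^ (a + 1) * Real.exp (-(z.re / 2 * t))) hs
    (.of_forall fun w => by fun_prop)
    (integrableOn_rpow_mul_cexp_neg_mul ha hz) (by fun_prop) ?_
    (integrableOn_rpow_mul_exp_neg_mul (by linarith) (half_pos hz)) ?_).2
  · refine ae_restrict_of_forall_mem measurableSet_Ioi fun t (ht : 0 < t) w hw => ?_
    rw [norm_neg, norm_mul, norm_rpow_mul_cexp_neg_mul a w ht, Complex.norm_real,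
      Real.norm_of_nonneg ht.le, Real.rpow_add_one ht.ne', ← mul_assoc, mul_comm t]
    have : z.re / 2 ≤ w.re := le_of_lt hw
    gcongr
  · refine .of_forall fun t w _ => ?_
    have h : HasDerivAt (fun w : ℂ => -(w * t)) (-(1 * t)) w :=
      ((hasDerivAt_id w).mul_const (t : ℂ)).neg
    exact (h.cexp.const_mul _).congr_deriv (by ring)

/-- The Laplace transform of `t ^ (a - 1)` on the right half-plane. -/
theorem integral_rpow_mul_cexp_neg_mul_Ioi {a : ℝ} {z : ℂ} (ha : 0 < a) (hz : 0 < z.re) :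
    ∫ t in Ioi (0:ℝ), ((t ^ (a - 1) : ℝ) : ℂ) * Complex.exp (-(z * t)) =
      Real.Gamma a * z ^ (-a : ℂ) := by
  have hopen : IsOpen {w : ℂ | 0 < w.re} := isOpen_lt continuous_const Complex.continuous_re
  have hF : AnalyticOnNhd ℂ (fun w : ℂ =>
      ∫ t in Ioi (0:ℝ), ((t ^ (a - 1) : ℝ) : ℂ) * Complex.exp (-(w * t))) {w | 0 < w.re} :=
    DifferentiableOn.analyticOnNhd (fun w hw => (hasDerivAt_integral_rpow_mul_cexp_neg_mul
      (by linarith) hw).differentiableAt.differentiableWithinAt) hopen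
  have hG : AnalyticOnNhd ℂ (fun w : ℂ => Real.Gamma a * w ^ (-a : ℂ)) {w | 0 < w.re} :=
    DifferentiableOn.analyticOnNhd (fun w hw => ((differentiableAt_id.cpow_const
      (Or.inl hw)).const_mul _).differentiableWithinAt) hopen
  refine hF.eqOn_of_preconnected_of_frequently_eq hG
    (convex_halfSpace_re_gt 0).isPreconnected (z₀ := 1) (by simp) ?_ hz
  have hlim : Tendsto ((↑) : ℝ → ℂ) (𝓝[≠] 1) (𝓝[≠] 1) := by
    refine tendsto_nhdsWithin_iff.2 ⟨?_, ?_⟩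
    · exact (Complex.continuous_ofReal.tendsto' 1 1 (by simp)).mono_left nhdsWithin_le_nhds
    · filter_upwards [self_mem_nhdsWithin] with r hr
      simpa using hr
  refine hlim.frequently (Eventually.frequently ?_)
  filter_upwards [mem_nhdsWithin_of_mem_nhds (Ioi_mem_nhds one_pos)] with r (hr : 0 < r)
  calc ∫ t in Ioi (0:ℝ), ((t ^ (a - 1) : ℝ) : ℂ) * Complex.exp (-(r * t))
      = ∫ t in Ioi (0:ℝ), ((t ^ (a - 1) * Real.exp (-(r * t)) : ℝ) : ℂ) := by
        simp only [Complex.ofReal_mul, Complex.ofReal_exp, Complex.ofReal_neg]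
    _ = Real.Gamma a * (r : ℂ) ^ (-a : ℂ) := by
        rw [integral_complex_ofReal, Real.integral_rpow_mul_exp_neg_mul_Ioi ha hr, one_div,
          Real.inv_rpow hr.le, ← Real.rpow_neg hr.le, mul_comm]
        simp [Complex.ofReal_cpow hr.le]

lemma Complex.arg_eq_arctan_of_re_pos {z : ℂ} (hz : 0 < z.re) :
    z.arg = Real.arctan (z.im / z.re) := by
  have h := abs_lt.1 (Complex.abs_arg_lt_pi_div_two_iff.2 (Or.inl hz))
  rw [← Complex.tan_arg, Real.arctan_tan h.1 h.2]

theorem integral_rpow_mul_exp_neg_mul_cos (n p q : ℝ) (hn : 0 < n) (hp : 0 < p) (hq : 0 < q) :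
    ∫ x in Set.Ioi (0:ℝ), x ^ (n - 1) * Real.exp (-(p * x)) * Real.cos (q * x) =
      Real.Gamma n * Real.cos (n * Real.arctan (q / p)) / Real.sqrt (p ^ 2 + q ^ 2) ^ n := by
  set z : ℂ := ⟨p, q⟩
  have hz : 0 < z.re := hp
  have hnorm : ‖z‖ = Real.sqrt (p ^ 2 + q ^ 2) := by
    rw [Complex.norm_def, Complex.normSq_mk, sq, sq]
  calc ∫ x in Ioi (0:ℝ), x ^ (n - 1) * Real.exp (-(p * x)) * Real.cos (q * x)
      = ∫ x in Ioi (0:ℝ), (((x ^ (n - 1) : ℝ) : ℂ) * Complex.exp (-(z * x))).re := by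
        congr! 2 with x
        rw [Complex.re_ofReal_mul, Complex.exp_re]
        simp [z, mul_assoc]
    _ = (Real.Gamma n * z ^ (-n : ℂ)).re := by
        rw [← integral_rpow_mul_cexp_neg_mul_Ioi hn hz]
        exact integral_re (integrableOn_rpow_mul_cexp_neg_mul (by linarith) hz)
    _ = _ := by
        rw [Complex.re_ofReal_mul, ← Complex.ofReal_neg, Complex.cpow_ofReal_re,
          Complex.arg_eq_arctan_of_re_pos hz, hnorm, Real.rpow_neg (Real.sqrt_nonneg _),
          mul_neg, Real.cos_neg, mul_comm n]
        ring
end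

section
/- Let p and q be positive real numbers and set f = √(p² + q²). Then the integral of e^(-px)·sin(qx)/√x over x from 0 to infinity equals (√π/f)·√((f - p)/2). -/
theorem integral_exp_neg_mul_sin_div_sqrt (p q : ℝ) (hp : 0 < p) (hq : 0 < q) :
    ∫ x in Set.Ioi (0:ℝ), Real.exp (-(p * x)) * Real.sin (q * x) / Real.sqrt x =
      Real.sqrt Real.pi / Real.sqrt (p ^ 2 + q ^ 2) *
        Real.sqrt ((Real.sqrt (p ^ 2 + q ^ 2) - p) / 2) := by
  have hpq : 0 < p ^ 2 + q ^ 2 := by positivity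
  have hπ := Real.pi_pos
  let b : ℂ := ⟨p, -q⟩
  have hb : 0 < b.re := hp
  have hsq : Complex.normSq b = p ^ 2 + q ^ 2 := by
    simp only [b, Complex.normSq_mk]
    ring
  have hnorm : ‖b‖ = Real.sqrt (p ^ 2 + q ^ 2) := by
    rw [Complex.norm_def, hsq]
  have hre : ((Real.pi : ℂ) / b).re = Real.pi * p / (p ^ 2 + q ^ 2) := by
    simp [Complex.div_re, hsq, b]
  have him : ((Real.pi : ℂ) / b).im = Real.pi * q / (p ^ 2 + q ^ 2) := by
    simp [Complex.div_im, hsq, b, neg_div]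
  have hroot : (((Real.pi : ℂ) / b) ^ (1 / 2 : ℂ)).im =
      Real.sqrt Real.pi / Real.sqrt (p ^ 2 + q ^ 2) *
        Real.sqrt ((Real.sqrt (p ^ 2 + q ^ 2) - p) / 2) := by
    rw [one_div, Complex.cpow_inv_two_im_eq_sqrt (by rw [him]; positivity), hre, norm_div,
      Complex.norm_real, Real.norm_of_nonneg hπ.le, hnorm, ← Real.sqrt_div hπ.le,
      ← Real.sqrt_mul (by positivity)]
    congr 1
    have hf : 0 < Real.sqrt (p ^ 2 + q ^ 2) := Real.sqrt_pos.mpr hpq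
    nth_rewrite 2 [← Real.sq_sqrt hpq.le]
    nth_rewrite 3 [← Real.sq_sqrt hpq.le]
    field_simp
  have hgauss : ∫ x in Set.Ioi (0 : ℝ), (Complex.exp (-b * (x : ℂ) ^ 2)).im =
      (((Real.pi : ℂ) / b) ^ (1 / 2 : ℂ)).im / 2 := by
    have h := integral_im (𝕜 := ℂ)
      (integrable_cexp_neg_mul_sq hb).integrableOn (μ := MeasureTheory.volume.restrict (Set.Ioi 0))
    rw [integral_gaussian_complex_Ioi hb] at h
    simpa using h
  rw [← hroot, ← MeasureTheory.integral_comp_rpow_Ioi_of_pos two_pos,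
    ← mul_div_cancel₀ (((Real.pi : ℂ) / b) ^ (1 / 2 : ℂ)).im (two_ne_zero (α := ℝ)),
    ← hgauss, ← MeasureTheory.integral_const_mul]
  refine MeasureTheory.setIntegral_congr_fun measurableSet_Ioi fun x hx => ?_
  have hx : 0 < x := hx
  have hexp : (Complex.exp (-b * (x : ℂ) ^ 2)).im =
      Real.exp (-(p * x ^ 2)) * Real.sin (q * x ^ 2) := by
    simp [Complex.exp_im, ← Complex.ofReal_pow, b]
  simp only [Real.rpow_two, hexp, Real.sqrt_sq hx.le, smul_eq_mul]
  norm_num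
  field_simp
end

section
/- Let p and q be positive real numbers and set f = √(p² + q²). Then the integral of e^(-px)·cos(qx)/√x over x from 0 to infinity equals (√π/f)·√((f + p)/2). -/
theorem integral_exp_neg_mul_sq_mul_cos_Ioi {p : ℝ} (hp : 0 < p) (q : ℝ) :
    ∫ x in Set.Ioi (0:ℝ), Real.exp (-(p * x ^ 2)) * Real.cos (q * x ^ 2) =
      Real.sqrt ((‖(Real.pi / (p + q * Complex.I) : ℂ)‖ +
        (Real.pi / (p + q * Complex.I) : ℂ).re) / 2) / 2 := by
  have hb : 0 < (p + q * Complex.I : ℂ).re := by simpa using hp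
  have hre := integral_re (𝕜 := ℂ)
    (integrable_cexp_neg_mul_sq hb).integrableOn (μ := MeasureTheory.volume.restrict (Set.Ioi 0))
  rw [integral_gaussian_complex_Ioi hb, one_div, RCLike.re_eq_complex_re, Complex.div_ofNat_re,
    Complex.cpow_inv_two_re] at hre
  rw [← hre]
  refine MeasureTheory.setIntegral_congr_fun measurableSet_Ioi fun x _ ↦ ?_
  simp [Complex.exp_re, ← Complex.ofReal_pow]

theorem integral_exp_neg_mul_cos_div_sqrt (p q : ℝ) (hp : 0 < p) (hq : 0 < q) :
    ∫ x in Set.Ioi (0:ℝ), Real.exp (-(p * x)) * Real.cos (q * x) / Real.sqrt x =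
      Real.sqrt Real.pi / Real.sqrt (p ^ 2 + q ^ 2) *
        Real.sqrt ((Real.sqrt (p ^ 2 + q ^ 2) + p) / 2) := by
  have hsub : ∫ x in Set.Ioi (0:ℝ), Real.exp (-(p * x)) * Real.cos (q * x) / Real.sqrt x =
      2 * ∫ x in Set.Ioi (0:ℝ), Real.exp (-(p * x ^ 2)) * Real.cos (q * x ^ 2) := by
    rw [← MeasureTheory.integral_comp_rpow_Ioi_of_pos two_pos, ← MeasureTheory.integral_const_mul]
    refine MeasureTheory.setIntegral_congr_fun measurableSet_Ioi fun x (hx : 0 < x) ↦ ?_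
    norm_num [Real.sqrt_sq hx.le]
    field_simp
  set f := Real.sqrt (p ^ 2 + q ^ 2) with hf
  have hf0 : 0 < f := by positivity
  have hf2 : f ^ 2 = p ^ 2 + q ^ 2 := Real.sq_sqrt (by positivity)
  have hnorm : ‖(p + q * Complex.I : ℂ)‖ = f := Complex.norm_add_mul_I p q
  have hre : (Real.pi / (p + q * Complex.I) : ℂ).re = Real.pi * p / f ^ 2 := by
    rw [Complex.div_re, Complex.normSq_eq_norm_sq, hnorm]
    simp
  rw [hsub, integral_exp_neg_mul_sq_mul_cos_Ioi hp q, hre, norm_div, hnorm, Complex.norm_real,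
    Real.norm_of_nonneg Real.pi_pos.le, mul_div_cancel₀ _ two_ne_zero,
    show (Real.pi / f + Real.pi * p / f ^ 2) / 2 = Real.pi * ((f + p) / 2) / f ^ 2 by field_simp,
    Real.sqrt_div (by positivity), Real.sqrt_mul Real.pi_pos.le, Real.sqrt_sq hf0.le]
  ring
end

section
/- (Theorem III) Let p and q be positive real numbers and set θ = arctan(q/p). Then the integral of e^(-px)·sin(qx)/x over x from 0 to infinity equals θ. -/
open MeasureTheory Set in
theorem integral_exp_neg_mul_cos_Ioi {p : ℝ} (hp : 0 < p) (t : ℝ) :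
    ∫ x in Ioi (0 : ℝ), Real.exp (-(p * x)) * Real.cos (t * x) = p / (p ^ 2 + t ^ 2) := by
  have ha : (-p + t * Complex.I : ℂ).re < 0 := by simpa using hp
  have hre : ∀ x : ℝ, Real.exp (-(p * x)) * Real.cos (t * x) =
      RCLike.re (Complex.exp ((-p + t * Complex.I) * x)) := by
    intro x
    rw [RCLike.re_to_complex, Complex.exp_re]
    simp
  simp_rw [hre]
  rw [integral_re (integrableOn_exp_mul_complex_Ioi ha 0), integral_exp_mul_complex_Ioi ha 0]
  simp [Complex.normSq_apply, Complex.div_re, pow_two]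

open MeasureTheory Set in
theorem integrable_exp_neg_mul_cos_prod {p : ℝ} (hp : 0 < p) (q : ℝ) :
    Integrable (Function.uncurry fun t x : ℝ ↦ Real.exp (-(p * x)) * Real.cos (t * x))
      ((volume.restrict (uIoc 0 q)).prod (volume.restrict (Ioi 0))) := by
  have hexp : Integrable (fun x : ℝ ↦ Real.exp (-(p * x))) (volume.restrict (Ioi 0)) := by
    simpa [IntegrableOn] using exp_neg_integrableOn_Ioi 0 hp
  have hone : Integrable (fun _ : ℝ ↦ (1 : ℝ)) (volume.restrict (uIoc 0 q)) := by
    rw [uIoc]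
    exact integrable_const 1
  refine (hone.mul_prod hexp).mono' (by fun_prop) (.of_forall fun z ↦ ?_)
  simp only [Function.uncurry, norm_mul, Real.norm_eq_abs, Real.abs_exp, one_mul]
  exact mul_le_of_le_one_right (Real.exp_pos _).le (Real.abs_cos_le_one _)

theorem intervalIntegral_exp_neg_mul_cos (p q : ℝ) {x : ℝ} (hx : x ≠ 0) :
    ∫ t in (0 : ℝ)..q, Real.exp (-(p * x)) * Real.cos (t * x) =
      Real.exp (-(p * x)) * Real.sin (q * x) / x := by
  rw [intervalIntegral.integral_const_mul,
    intervalIntegral.integral_comp_mul_right (fun t ↦ Real.cos t) hx, integral_cos]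
  simp
  ring

theorem intervalIntegral_div_sq_add_sq {p : ℝ} (hp : p ≠ 0) (q : ℝ) :
    ∫ t in (0 : ℝ)..q, p / (p ^ 2 + t ^ 2) = Real.arctan (q / p) := by
  have h : ∀ t : ℝ, p / (p ^ 2 + t ^ 2) = p⁻¹ * (1 + (t / p) ^ 2)⁻¹ := by
    intro t
    have : p ^ 2 + t ^ 2 ≠ 0 := by positivity
    field_simp
  simp_rw [h]
  rw [intervalIntegral.integral_const_mul,
    intervalIntegral.integral_comp_div (fun t ↦ (1 + t ^ 2)⁻¹) hp, integral_inv_one_add_sq]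
  simp [hp]

theorem integral_exp_neg_mul_sin_div_self (p q : ℝ) (hp : 0 < p) (hq : 0 < q) :
    ∫ x in Set.Ioi (0:ℝ), Real.exp (-(p * x)) * Real.sin (q * x) / x =
      Real.arctan (q / p) := by
  rw [← intervalIntegral_div_sq_add_sq hp.ne' q]
  simp_rw [← integral_exp_neg_mul_cos_Ioi hp]
  rw [MeasureTheory.intervalIntegral_integral_swap (integrable_exp_neg_mul_cos_prod hp q)]
  exact MeasureTheory.setIntegral_congr_fun measurableSet_Ioi fun x hx ↦
    (intervalIntegral_exp_neg_mul_cos p q (ne_of_gt hx)).symm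
end

section
/- The improper integral of sin(φ)/√φ over φ from 0 to infinity equals √(π/2); that is, the function T ↦ ∫₀^T sin(φ)/√φ dφ tends to √(π/2) as T → ∞. -/
open MeasureTheory Filter Topology Set

/-- An antiderivative of the reciprocal of `1 + u ^ 4`. -/
lemma hasDerivAt_arctan_add_log_quartic (u : ℝ) :
    HasDerivAt (fun x : ℝ => (Real.arctan (√2 * x + 1) + Real.arctan (√2 * x - 1)) / (2 * √2) +
      Real.log ((x ^ 2 + √2 * x + 1) / (x ^ 2 - √2 * x + 1)) / (4 * √2)) (1 / (1 + u ^ 4)) u := by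
  have hs : √2 ^ 2 = (2 : ℝ) := Real.sq_sqrt (by norm_num)
  have hp : 0 < u ^ 2 + √2 * u + 1 := by nlinarith [sq_nonneg (√2 * u + 1)]
  have hm : 0 < u ^ 2 - √2 * u + 1 := by nlinarith [sq_nonneg (√2 * u - 1)]
  have hl : HasDerivAt (fun x : ℝ => √2 * x) √2 u := by
    simpa using (hasDerivAt_id u).const_mul √2
  have hq : HasDerivAt (fun x : ℝ => x ^ 2) (2 * u) u := by
    simpa using hasDerivAt_pow 2 u
  have hP := (hq.add hl).add_const 1
  have hM := (hq.sub hl).add_const 1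
  have h := (((hl.add_const 1).arctan.add (hl.sub_const 1).arctan).div_const (2 * √2)).add
    (((hP.div hM hm.ne').log (div_pos hp hm).ne').div_const (4 * √2))
  refine h.congr_deriv ?_
  have h1 : 1 + (√2 * u + 1) ^ 2 = 2 * (u ^ 2 + √2 * u + 1) := by linear_combination u ^ 2 * hs
  have h2 : 1 + (√2 * u - 1) ^ 2 = 2 * (u ^ 2 - √2 * u + 1) := by linear_combination u ^ 2 * hs
  have h3 : 1 + u ^ 4 = (u ^ 2 + √2 * u + 1) * (u ^ 2 - √2 * u + 1) := by
    linear_combination u ^ 2 * hs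
  simp only [Pi.add_apply, Pi.sub_apply, Pi.div_apply]
  rw [h1, h2, h3]
  generalize hPe : u ^ 2 + √2 * u + 1 = P at hp ⊢
  generalize hMe : u ^ 2 - √2 * u + 1 = M at hm ⊢
  field_simp
  subst hPe hMe
  ring

lemma tendsto_arctan_add_log_quartic :
    Tendsto (fun x : ℝ => (Real.arctan (√2 * x + 1) + Real.arctan (√2 * x - 1)) / (2 * √2) +
      Real.log ((x ^ 2 + √2 * x + 1) / (x ^ 2 - √2 * x + 1)) / (4 * √2)) atTop
      (𝓝 (Real.pi / (2 * √2))) := by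
  have hs0 : 0 < √2 := by positivity
  have hl : Tendsto (fun x : ℝ => √2 * x) atTop atTop := tendsto_id.const_mul_atTop hs0
  have ha : Tendsto (fun x : ℝ => Real.arctan (√2 * x + 1)) atTop (𝓝 (Real.pi / 2)) :=
    (Real.tendsto_arctan_atTop.mono_right nhdsWithin_le_nhds).comp
      (tendsto_atTop_add_const_right _ 1 hl)
  have hb : Tendsto (fun x : ℝ => Real.arctan (√2 * x - 1)) atTop (𝓝 (Real.pi / 2)) :=
    (Real.tendsto_arctan_atTop.mono_right nhdsWithin_le_nhds).comp
      (tendsto_atTop_add_const_right _ (-1) hl)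
  have hq : Tendsto (fun x : ℝ => (x ^ 2 + √2 * x + 1) / (x ^ 2 - √2 * x + 1)) atTop (𝓝 1) := by
    have hi : Tendsto (fun x : ℝ => x⁻¹) atTop (𝓝 0) := tendsto_inv_atTop_zero
    have h1 : Tendsto (fun x : ℝ => (1 + √2 * x⁻¹ + x⁻¹ ^ 2) / (1 - √2 * x⁻¹ + x⁻¹ ^ 2)) atTop
        (𝓝 ((1 + √2 * 0 + 0 ^ 2) / (1 - √2 * 0 + 0 ^ 2))) :=
      (((hi.const_mul √2).const_add 1).add (hi.pow 2)).div
        (((hi.const_mul √2).const_sub 1).add (hi.pow 2)) (by norm_num)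
    rw [show (1 + √2 * 0 + 0 ^ 2) / (1 - √2 * 0 + 0 ^ 2) = 1 by norm_num] at h1
    refine h1.congr' ?_
    filter_upwards [eventually_gt_atTop 0] with x hx
    rw [← mul_div_mul_left _ _ (pow_pos hx 2).ne']
    congr 1 <;> field_simp
  have hlog := (hq.log one_ne_zero).div_const (4 * √2)
  have h := ((ha.add hb).div_const (2 * √2)).add hlog
  convert! h using 2
  simp

lemma integrableOn_one_div_one_add_pow_four :
    IntegrableOn (fun u : ℝ => 1 / (1 + u ^ 4)) (Ioi 0) :=
  integrableOn_Ioi_deriv_of_nonneg'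
    (fun u _ => hasDerivAt_arctan_add_log_quartic u) (fun u _ => by positivity)
    tendsto_arctan_add_log_quartic

lemma integral_Ioi_one_div_one_add_pow_four :
    ∫ u in Ioi (0 : ℝ), 1 / (1 + u ^ 4) = Real.pi / (2 * √2) := by
  rw [integral_Ioi_of_hasDerivAt_of_nonneg'
    (fun u _ => hasDerivAt_arctan_add_log_quartic u) (fun u _ => by positivity)
    tendsto_arctan_add_log_quartic]
  simp [Real.arctan_neg]

lemma integral_sin_mul_exp_neg_mul (a T : ℝ) :
    ∫ x in (0 : ℝ)..T, Real.sin x * Real.exp (-a * x) =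
      1 / (1 + a ^ 2) - Real.exp (-a * T) * ((a * Real.sin T + Real.cos T) / (1 + a ^ 2)) := by
  have h0 : 1 + a ^ 2 ≠ 0 := by positivity
  have hd (x : ℝ) : HasDerivAt
      (fun x => -(Real.exp (-a * x) * ((a * Real.sin x + Real.cos x) / (1 + a ^ 2))))
      (Real.sin x * Real.exp (-a * x)) x := by
    have he : HasDerivAt (fun x => Real.exp (-a * x)) (Real.exp (-a * x) * -a) x := by
      simpa using ((hasDerivAt_id x).const_mul (-a)).exp
    refine (he.mul ((((Real.hasDerivAt_sin x).const_mul a).add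
      (Real.hasDerivAt_cos x)).div_const (1 + a ^ 2))).neg.congr_deriv ?_
    simp only [Pi.add_apply]
    field_simp
    ring
  rw [intervalIntegral.integral_eq_sub_of_hasDerivAt (fun x _ => hd x)
    (Continuous.intervalIntegrable (by fun_prop) _ _)]
  simp
  ring

lemma integrable_sin_mul_exp_neg_mul_sq_prod {T : ℝ} (hT : 0 ≤ T) :
    Integrable (Function.uncurry fun x u : ℝ => Real.sin x * Real.exp (-x * u ^ 2))
      ((volume.restrict (Ioc 0 T)).prod (volume.restrict (Ioi 0))) := by
  have hc : Continuous
      (Function.uncurry fun x u : ℝ => Real.sin x * Real.exp (-x * u ^ 2)) := by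
    unfold Function.uncurry; fun_prop
  rw [integrable_prod_iff hc.aestronglyMeasurable]
  constructor
  · filter_upwards [ae_restrict_mem measurableSet_Ioc] with x hx
    exact ((integrable_exp_neg_mul_sq hx.1).const_mul (Real.sin x)).integrableOn
  · have hi : IntegrableOn (fun x : ℝ => x ^ (-1 / 2 : ℝ)) (Ioc 0 T) :=
      (intervalIntegrable_iff_integrableOn_Ioc_of_le hT).1
        (intervalIntegral.intervalIntegrable_rpow' (by norm_num))
    refine (hi.const_mul (√Real.pi / 2)).mono'
      hc.aestronglyMeasurable.norm.integral_prod_right' ?_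
    filter_upwards [ae_restrict_mem measurableSet_Ioc] with x hx
    simp only [Function.uncurry_apply_pair, norm_mul, Real.norm_eq_abs, Real.abs_exp]
    rw [integral_const_mul, integral_gaussian_Ioi, abs_mul, abs_abs,
      abs_of_nonneg (show 0 ≤ √(Real.pi / x) / 2 by positivity),
      Real.sqrt_div Real.pi_pos.le, neg_div, Real.rpow_neg hx.1.le, ← Real.sqrt_eq_rpow]
    calc |Real.sin x| * (√Real.pi / √x / 2) ≤ 1 * (√Real.pi / √x / 2) := by
          gcongr
          exact Real.abs_sin_le_one x
      _ = √Real.pi / 2 * (√x)⁻¹ := by ring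

lemma norm_exp_mul_div_one_add_pow_four_le (T u : ℝ) :
    ‖Real.exp (-T * u ^ 2) * ((u ^ 2 * Real.sin T + Real.cos T) / (1 + u ^ 4))‖ ≤
      2 * Real.exp (-T * u ^ 2) := by
  rw [norm_mul, Real.norm_eq_abs, Real.abs_exp, mul_comm]
  gcongr
  rw [Real.norm_eq_abs, abs_div, abs_of_pos (show 0 < 1 + u ^ 4 by positivity),
    div_le_iff₀ (by positivity)]
  have := Real.abs_sin_le_one T
  calc |u ^ 2 * Real.sin T + Real.cos T| ≤ |u ^ 2 * Real.sin T| + |Real.cos T| := abs_add_le _ _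
    _ = u ^ 2 * |Real.sin T| + |Real.cos T| := by rw [abs_mul, abs_of_nonneg (sq_nonneg u)]
    _ ≤ u ^ 2 * 1 + 1 := by
      gcongr
      exact Real.abs_cos_le_one T
    _ ≤ 2 * (1 + u ^ 4) := by nlinarith [sq_nonneg (u ^ 2 - 1)]

lemma integrableOn_exp_mul_div_one_add_pow_four {T : ℝ} (hT : 0 < T) :
    IntegrableOn (fun u : ℝ =>
      Real.exp (-T * u ^ 2) * ((u ^ 2 * Real.sin T + Real.cos T) / (1 + u ^ 4))) (Ioi 0) := by
  refine ((integrable_exp_neg_mul_sq hT).const_mul 2).integrableOn.mono' ?_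
    (ae_of_all _ (norm_exp_mul_div_one_add_pow_four_le T))
  refine Continuous.aestronglyMeasurable ?_
  have h (u : ℝ) : 1 + u ^ 4 ≠ 0 := by positivity
  fun_prop (disch := assumption)

lemma tendsto_integral_exp_mul_div_one_add_pow_four :
    Tendsto (fun T : ℝ => ∫ u in Ioi (0 : ℝ),
      Real.exp (-T * u ^ 2) * ((u ^ 2 * Real.sin T + Real.cos T) / (1 + u ^ 4))) atTop (𝓝 0) := by
  have hlim : Tendsto (fun T : ℝ => √(Real.pi / T)) atTop (𝓝 0) := by
    simpa using (tendsto_id.const_div_atTop Real.pi).sqrt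
  refine squeeze_zero_norm' ?_ hlim
  filter_upwards [eventually_gt_atTop 0] with T hT
  refine (norm_integral_le_of_norm_le
    ((integrable_exp_neg_mul_sq hT).const_mul 2).integrableOn
    (ae_of_all _ (norm_exp_mul_div_one_add_pow_four_le T))).trans_eq ?_
  rw [integral_const_mul, integral_gaussian_Ioi]
  ring

lemma integral_sin_div_sqrt_eq {T : ℝ} (hT : 0 < T) :
    ∫ x in (0 : ℝ)..T, Real.sin x / √x = 2 / √Real.pi * (Real.pi / (2 * √2) -
      ∫ u in Ioi (0 : ℝ),
        Real.exp (-T * u ^ 2) * ((u ^ 2 * Real.sin T + Real.cos T) / (1 + u ^ 4))) := by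
  have hpi : 0 < √Real.pi := Real.sqrt_pos.2 Real.pi_pos
  calc ∫ x in (0 : ℝ)..T, Real.sin x / √x
      = ∫ x in Ioc 0 T, 2 / √Real.pi * ∫ u in Ioi (0 : ℝ), Real.sin x * Real.exp (-x * u ^ 2) := by
        rw [intervalIntegral.integral_of_le hT.le]
        refine setIntegral_congr_fun measurableSet_Ioc fun x hx => ?_
        have : 0 < √x := Real.sqrt_pos.2 hx.1
        rw [integral_const_mul, integral_gaussian_Ioi, Real.sqrt_div Real.pi_pos.le]
        field_simp
    _ = 2 / √Real.pi * ∫ u in Ioi (0 : ℝ), ∫ x in Ioc 0 T,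
          Real.sin x * Real.exp (-x * u ^ 2) := by
        rw [integral_const_mul, integral_integral_swap
          (integrable_sin_mul_exp_neg_mul_sq_prod hT.le)]
    _ = 2 / √Real.pi * ∫ u in Ioi (0 : ℝ), (1 / (1 + u ^ 4) -
          Real.exp (-T * u ^ 2) * ((u ^ 2 * Real.sin T + Real.cos T) / (1 + u ^ 4))) := by
        congr 2 with u
        rw [← intervalIntegral.integral_of_le hT.le]
        have h := integral_sin_mul_exp_neg_mul (u ^ 2) T
        rw [← pow_mul] at h
        simpa only [neg_mul, mul_comm (u ^ 2) T, mul_comm (u ^ 2) (_ : ℝ)] using h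
    _ = _ := by
        rw [integral_sub integrableOn_one_div_one_add_pow_four
          (integrableOn_exp_mul_div_one_add_pow_four hT), integral_Ioi_one_div_one_add_pow_four]

theorem tendsto_integral_sin_div_sqrt :
    Filter.Tendsto (fun T : ℝ => ∫ φ in (0:ℝ)..T, Real.sin φ / Real.sqrt φ)
      Filter.atTop (nhds (Real.sqrt (Real.pi / 2))) := by
  have h := (tendsto_integral_exp_mul_div_one_add_pow_four.const_sub
    (Real.pi / (2 * √2))).const_mul (2 / √Real.pi)
  have hpi : 0 < √Real.pi := Real.sqrt_pos.2 Real.pi_pos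
  have hv : 2 / √Real.pi * (Real.pi / (2 * √2) - 0) = √(Real.pi / 2) := by
    rw [Real.sqrt_div Real.pi_pos.le]
    rw [sub_zero]
    field_simp
    rw [Real.sq_sqrt Real.pi_pos.le]
  rw [hv] at h
  refine h.congr' ?_
  filter_upwards [eventually_gt_atTop 0] with T hT
  exact (integral_sin_div_sqrt_eq hT).symm
end

section
/- The improper integral of cos(φ)/√φ over φ from 0 to infinity equals √(π/2); that is, the function T ↦ ∫₀^T cos(φ)/√φ dφ tends to √(π/2) as T → ∞. -/
open MeasureTheory Set Filter Topology Real

/-- The inner integral in the Gaussian representation of `∫ cos φ / √φ`. -/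
lemma integral_cos_mul_exp_neg_mul (a T : ℝ) :
    ∫ φ in (0:ℝ)..T, cos φ * exp (-a * φ) =
      exp (-a * T) * (sin T - a * cos T) / (1 + a ^ 2) + a / (1 + a ^ 2) := by
  have ha : 1 + a ^ 2 ≠ 0 := by positivity
  have hderiv (x : ℝ) : HasDerivAt
      (fun φ => exp (-a * φ) * (sin φ - a * cos φ) / (1 + a ^ 2)) (cos x * exp (-a * x)) x := by
    have hexp : HasDerivAt (fun φ => exp (-a * φ)) (exp (-a * x) * -a) x := by
      simpa using ((hasDerivAt_id x).const_mul (-a)).exp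
    have htrig := (hasDerivAt_sin x).sub ((hasDerivAt_cos x).const_mul a)
    refine ((hexp.mul htrig).div_const (1 + a ^ 2)).congr_deriv ?_
    simp only [Pi.sub_apply]
    field_simp
    ring
  rw [intervalIntegral.integral_eq_sub_of_hasDerivAt (fun x _ => hderiv x)
    (Continuous.intervalIntegrable (by fun_prop) _ _)]
  simp
  ring

lemma integrableOn_inv_sqrt (T : ℝ) : IntegrableOn (fun φ : ℝ => √(π / φ) / 2) (Ioc 0 T) := by
  rcases le_total T 0 with hT | hT
  · simp [hT]
  have h := (intervalIntegral.intervalIntegrable_rpow' (a := 0) (b := T)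
    (r := -(1 / 2)) (by norm_num)).1
  refine IntegrableOn.congr_fun (h.const_mul (√π / 2)) (fun φ hφ => ?_) measurableSet_Ioc
  simp only [sqrt_div pi_pos.le, rpow_neg hφ.1.le, ← sqrt_eq_rpow]
  ring

lemma integrable_cos_mul_exp_neg_sq_mul (T : ℝ) :
    Integrable (fun p : ℝ × ℝ => cos p.1 * exp (-p.2 ^ 2 * p.1))
      ((volume.restrict (Ioc 0 T)).prod (volume.restrict (Ioi 0))) := by
  rw [integrable_prod_iff (by fun_prop)]
  constructor
  · filter_upwards [ae_restrict_mem measurableSet_Ioc] with φ hφ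
    refine (((integrable_exp_neg_mul_sq hφ.1).const_mul (cos φ)).restrict (s := Ioi 0)).congr ?_
    filter_upwards with u
    ring_nf
  · refine Integrable.mono' (integrableOn_inv_sqrt T) ?_ ?_
    · have hcont : Continuous fun p : ℝ × ℝ => cos p.1 * exp (-p.2 ^ 2 * p.1) := by fun_prop
      exact hcont.norm.aestronglyMeasurable.integral_prod_right'
    · filter_upwards [ae_restrict_mem measurableSet_Ioc] with φ hφ
      rw [← integral_gaussian_Ioi, norm_of_nonneg (integral_nonneg fun _ => norm_nonneg _)]
      refine integral_mono_of_nonneg (ae_of_all _ fun _ => norm_nonneg _)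
        (integrable_exp_neg_mul_sq hφ.1).restrict (ae_of_all _ fun u => ?_)
      simp only [norm_mul, norm_eq_abs, abs_exp]
      rw [show -u ^ 2 * φ = -φ * u ^ 2 by ring]
      exact mul_le_of_le_one_left (exp_pos _).le (abs_cos_le_one φ)

lemma integral_cos_div_sqrt_eq {T : ℝ} (hT : 0 ≤ T) :
    ∫ φ in (0:ℝ)..T, cos φ / √φ = 2 / √π * ∫ u in Ioi (0:ℝ),
      (exp (-u ^ 2 * T) * (sin T - u ^ 2 * cos T) / (1 + (u ^ 2) ^ 2)
        + u ^ 2 / (1 + (u ^ 2) ^ 2)) := by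
  have hπ : √π ≠ 0 := (sqrt_pos.2 pi_pos).ne'
  simp_rw [← integral_cos_mul_exp_neg_mul, intervalIntegral.integral_of_le hT]
  rw [← integral_integral_swap (f := fun φ u => cos φ * exp (-u ^ 2 * φ))
    (integrable_cos_mul_exp_neg_sq_mul T), ← integral_const_mul]
  refine setIntegral_congr_fun measurableSet_Ioc fun φ hφ => ?_
  have hφ' : √φ ≠ 0 := (sqrt_pos.2 hφ.1).ne'
  have h (u : ℝ) : -u ^ 2 * φ = -φ * u ^ 2 := by ring
  simp only [h, integral_const_mul, integral_gaussian_Ioi, sqrt_div pi_pos.le]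
  field_simp

lemma hasDerivAt_primitive_sq_div_one_add_pow_four (u : ℝ) :
    HasDerivAt (fun u => (arctan (√2 * u + 1) + arctan (√2 * u - 1)) / (2 * √2)
        + log ((u ^ 2 - √2 * u + 1) / (u ^ 2 + √2 * u + 1)) / (4 * √2))
      (u ^ 2 / (1 + (u ^ 2) ^ 2)) u := by
  have h2 : √2 ^ 2 = 2 := sq_sqrt (by norm_num)
  have h0 : √2 ≠ 0 := by positivity
  have hp : 0 < u ^ 2 + √2 * u + 1 := by nlinarith [sq_nonneg (√2 * u + 1)]
  have hm : 0 < u ^ 2 - √2 * u + 1 := by nlinarith [sq_nonneg (√2 * u - 1)]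
  have hl : HasDerivAt (fun u => √2 * u) √2 u := by simpa using (hasDerivAt_id u).const_mul √2
  have hsq : HasDerivAt (fun u : ℝ => u ^ 2) (2 * u) u := by simpa using hasDerivAt_pow 2 u
  have harctan := ((hl.add_const 1).arctan.add (hl.sub_const 1).arctan).div_const (2 * √2)
  have hlog := ((((hsq.sub hl).add_const 1).div ((hsq.add hl).add_const 1) hp.ne').log
    (div_pos hm hp).ne').div_const (4 * √2)
  refine (harctan.add hlog).congr_deriv ?_
  have e1 : 1 + (√2 * u + 1) ^ 2 = 2 * (u ^ 2 + √2 * u + 1) := by linear_combination u ^ 2 * h2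
  have e2 : 1 + (√2 * u - 1) ^ 2 = 2 * (u ^ 2 - √2 * u + 1) := by linear_combination u ^ 2 * h2
  have e3 : 1 + (u ^ 2) ^ 2 = (u ^ 2 + √2 * u + 1) * (u ^ 2 - √2 * u + 1) := by
    linear_combination u ^ 2 * h2
  simp only [Pi.add_apply, Pi.sub_apply, Pi.div_apply]
  rw [e1, e2, e3]
  have hdiff : (u ^ 2 + √2 * u + 1) - (u ^ 2 - √2 * u + 1) = 2 * √2 * u := by ring
  generalize u ^ 2 + √2 * u + 1 = p at *
  generalize u ^ 2 - √2 * u + 1 = q at *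
  field_simp
  linear_combination 8 * u * hdiff

lemma tendsto_log_quadratic_ratio_atTop :
    Tendsto (fun u : ℝ => log ((u ^ 2 - √2 * u + 1) / (u ^ 2 + √2 * u + 1))) atTop (𝓝 0) := by
  have hinv : Tendsto (fun u : ℝ => u⁻¹) atTop (𝓝 0) := tendsto_inv_atTop_zero
  have hnum := ((hinv.const_mul √2).const_sub 1).add (hinv.pow 2)
  have hden := ((hinv.const_mul √2).const_add 1).add (hinv.pow 2)
  have h := (hnum.div hden (by norm_num)).log (by norm_num)
  have h' : log ((1 - √2 * 0 + 0 ^ 2) / (1 + √2 * 0 + 0 ^ 2)) = 0 := by simp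
  rw [h'] at h
  refine h.congr' ?_
  filter_upwards [eventually_gt_atTop 0] with u hu
  congr 1
  simp only [Pi.div_apply]
  have hp : u ^ 2 + √2 * u + 1 ≠ 0 := by positivity
  have hq : 1 + √2 * u⁻¹ + u⁻¹ ^ 2 ≠ 0 := by positivity
  rw [div_eq_div_iff hq hp]
  field_simp

lemma integrableOn_Ioi_inv_one_add_sq : IntegrableOn (fun u : ℝ => 4 * (1 + u ^ 2)⁻¹) (Ioi 0) :=
  (integrable_inv_one_add_sq.const_mul 4).integrableOn

lemma integral_Ioi_sq_div_one_add_pow_four :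
    ∫ u in Ioi (0:ℝ), u ^ 2 / (1 + (u ^ 2) ^ 2) = π / (2 * √2) := by
  have hlin : Tendsto (fun u : ℝ => √2 * u) atTop atTop :=
    tendsto_id.const_mul_atTop (by positivity)
  have harctan := tendsto_arctan_atTop.mono_right nhdsWithin_le_nhds
  have hlim := (((harctan.comp (tendsto_atTop_add_const_right _ 1 hlin)).add
    (harctan.comp (tendsto_atTop_add_const_right _ (-1) hlin))).div_const (2 * √2)).add
    (tendsto_log_quadratic_ratio_atTop.div_const (4 * √2))
  rw [integral_Ioi_of_hasDerivAt_of_nonneg'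
    (fun u _ => hasDerivAt_primitive_sq_div_one_add_pow_four u) (fun u _ => by positivity) hlim]
  simp [arctan_neg]

theorem tendsto_integral_cos_div_sqrt :
    Filter.Tendsto (fun T : ℝ => ∫ φ in (0:ℝ)..T, Real.cos φ / Real.sqrt φ)
      Filter.atTop (nhds (Real.sqrt (Real.pi / 2))) := by
  have hvalue : √(π / 2) = 2 / √π * ∫ u in Ioi (0:ℝ), u ^ 2 / (1 + (u ^ 2) ^ 2) := by
    have hπ : √π ≠ 0 := (sqrt_pos.2 pi_pos).ne'
    rw [integral_Ioi_sq_div_one_add_pow_four, sqrt_div pi_pos.le]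
    field_simp
    rw [sq_sqrt pi_pos.le]
  rw [hvalue]
  refine Tendsto.congr' (EventuallyEq.symm ((eventually_ge_atTop 0).mono
    fun T hT => integral_cos_div_sqrt_eq hT)) (Tendsto.const_mul _ ?_)
  have htrig (u T : ℝ) : |sin T - u ^ 2 * cos T| ≤ 1 + u ^ 2 := by
    have hc : |u ^ 2 * cos T| ≤ u ^ 2 := by
      rw [abs_mul, abs_sq]
      exact mul_le_of_le_one_right (sq_nonneg u) (abs_cos_le_one T)
    exact (abs_sub _ _).trans (add_le_add (abs_sin_le_one T) hc)
  refine tendsto_integral_filter_of_dominated_convergence (fun u => 4 * (1 + u ^ 2)⁻¹)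
    (Eventually.of_forall fun T => ?_) ?_ integrableOn_Ioi_inv_one_add_sq ?_
  · exact (by fun_prop : Measurable _).aestronglyMeasurable
  · filter_upwards [eventually_ge_atTop 0] with T hT
    refine ae_of_all _ fun u => ?_
    have hden : 0 < 1 + (u ^ 2) ^ 2 := by positivity
    have hexp : exp (-u ^ 2 * T) ≤ 1 := exp_le_one_iff.2 (by nlinarith [mul_nonneg (sq_nonneg u) hT])
    rw [← add_div, norm_div, norm_of_nonneg hden.le, ← div_eq_mul_inv,
      div_le_div_iff₀ hden (by positivity)]
    have hnum : ‖exp (-u ^ 2 * T) * (sin T - u ^ 2 * cos T) + u ^ 2‖ ≤ 1 + u ^ 2 + u ^ 2 := by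
      refine (norm_add_le _ _).trans (add_le_add ?_ (by simp))
      rw [norm_mul, norm_eq_abs, norm_eq_abs, abs_exp]
      exact (mul_le_of_le_one_left (abs_nonneg _) hexp).trans (htrig u T)
    calc _ ≤ (1 + u ^ 2 + u ^ 2) * (1 + u ^ 2) := by gcongr
      _ ≤ _ := by nlinarith [sq_nonneg (u ^ 2 - 1)]
  · filter_upwards [ae_restrict_mem measurableSet_Ioi] with u hu
    have hu2 : 0 < u ^ 2 := pow_pos hu 2
    have hexp : Tendsto (fun T => exp (-u ^ 2 * T)) atTop (𝓝 0) :=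
      tendsto_exp_atBot.comp (tendsto_id.const_mul_atTop_of_neg (neg_lt_zero.2 hu2))
    have hzero : Tendsto (fun T => exp (-u ^ 2 * T) * (sin T - u ^ 2 * cos T)) atTop (𝓝 0) := by
      refine squeeze_zero_norm (fun T => ?_) (by simpa only [zero_mul] using hexp.mul_const (1 + u ^ 2))
      rw [norm_mul, norm_eq_abs, norm_eq_abs, abs_exp]
      exact mul_le_mul_of_nonneg_left (htrig u T) (exp_pos _).le
    simpa using (hzero.div_const (1 + (u ^ 2) ^ 2)).add_const (u ^ 2 / (1 + (u ^ 2) ^ 2))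
end
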